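/- Let ρ be a density matrix on ℂ^{2^M} with N̂ρ = Nρ for some integer N (a state with fixed total fermion number N). Then ρ is (A₁,A₂)-separable if and only if both of the following hold: (i) P_k ρ P_l = 0 for all k ≠ l (ρ has no coherences between different eigenvalues of the local number operator N̂₁), and (ii) for every k with p_k = Tr[P_k ρ P_k] > 0, the density matrix P_k ρ P_k / p_k is (A₁,A₂)-separable. -/

import Mathlib

open scoped ComplexOrder
open Matrix

/-- The fermionic Fock space of `M` modes, realized as `ℂ^{2^M} = (ℂ²)^{⊗M}`;
matrices on it. -/
abbrev FockMat (M : ℕ) := Matrix (Fin M → Fin 2) (Fin M → Fin 2) ℂ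

/-- The Pauli matrix `σ₃`. -/
def pauli3 : Matrix (Fin 2) (Fin 2) ℂ := !![1, 0; 0, -1]

/-- The matrix `σ₋`. -/
def sigmaMinus : Matrix (Fin 2) (Fin 2) ℂ := !![0, 1; 0, 0]

/-- The Jordan–Wigner annihilation matrices
`a_j = σ₃^{⊗(j−1)} ⊗ σ₋ ⊗ σ₀^{⊗(M−j)}` (entrywise Kronecker-product formula). -/
def jw (M : ℕ) (j : Fin M) : FockMat M := fun x y =>
  ∏ i : Fin M,
    (if i < j then pauli3 else if i = j then sigmaMinus else (1 : Matrix (Fin 2) (Fin 2) ℂ))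
      (x i) (y i)

/-- The subalgebra `A₁` generated by the first `m` annihilation matrices. -/
noncomputable def fermionAlg₁ (M m : ℕ) : StarSubalgebra ℂ (FockMat M) :=
  StarAlgebra.adjoin ℂ {x : FockMat M | ∃ j : Fin M, (j : ℕ) < m ∧ x = jw M j}

/-- The subalgebra `A₂` generated by the remaining annihilation matrices. -/
noncomputable def fermionAlg₂ (M m : ℕ) : StarSubalgebra ℂ (FockMat M) :=
  StarAlgebra.adjoin ℂ {x : FockMat M | ∃ j : Fin M, m ≤ (j : ℕ) ∧ x = jw M j}

/-- A state on the matrix algebra `M_{2^M}(ℂ)`. -/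
def IsState {M : ℕ} (ω : FockMat M →ₗ[ℂ] ℂ) : Prop :=
  (∀ x : FockMat M, 0 ≤ ω (xᴴ * x)) ∧ ω 1 = 1

/-- The total number operator `N̂ = Σ_j a_j* a_j`. -/
noncomputable def numberOp (M : ℕ) : FockMat M := ∑ j : Fin M, (jw M j)ᴴ * jw M j

/-- The local number operator `N̂₁ = Σ_{j≤m} a_j* a_j` of the first partition. -/
noncomputable def numberOp₁ (M m : ℕ) : FockMat M :=
  ∑ j ∈ Finset.univ.filter (fun j : Fin M => (j : ℕ) < m), (jw M j)ᴴ * jw M j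

/-- Fermionic `(A₁,A₂)`-separability of a density matrix `ρ`: `Tr[ρ α₁α₂]` is a
convex combination of products of states, each product functional extending to a
state of the whole matrix algebra. -/
def IsSepDM (M m : ℕ) (ρ : FockMat M) : Prop :=
  ∃ (n : ℕ) (lam : Fin n → ℝ) (ω₁ ω₂ : Fin n → (FockMat M →ₗ[ℂ] ℂ)),
    (∀ k, 0 ≤ lam k) ∧ (∑ k, lam k) = 1 ∧
    (∀ k, IsState (ω₁ k)) ∧ (∀ k, IsState (ω₂ k)) ∧
    (∀ k, ∃ ω : FockMat M →ₗ[ℂ] ℂ, IsState ω ∧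
      ∀ α₁ ∈ fermionAlg₁ M m, ∀ α₂ ∈ fermionAlg₂ M m,
        ω (α₁ * α₂) = ω₁ k α₁ * ω₂ k α₂) ∧
    ∀ α₁ ∈ fermionAlg₁ M m, ∀ α₂ ∈ fermionAlg₂ M m,
      (ρ * (α₁ * α₂)).trace = ∑ k, (lam k : ℂ) * ω₁ k α₁ * ω₂ k α₂


/-- Tensor product of 2×2 matrices. -/
def tens {M : ℕ} (f : Fin M → Matrix (Fin 2) (Fin 2) ℂ) : FockMat M :=
  fun x y => ∏ i, f i (x i) (y i)

lemma tens_mul {M : ℕ} (f g : Fin M → Matrix (Fin 2) (Fin 2) ℂ) :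
    tens f * tens g = tens (fun i => f i * g i) := by
  ext x y
  simp only [Matrix.mul_apply, tens]
  rw [Finset.prod_univ_sum, Fintype.piFinset_univ]
  simp [Finset.prod_mul_distrib]

lemma tens_conj {M : ℕ} (f : Fin M → Matrix (Fin 2) (Fin 2) ℂ) :
    (tens f)ᴴ = tens (fun i => (f i)ᴴ) := by
  ext x y
  simp [tens, Matrix.conjTranspose_apply]

lemma tens_one {M : ℕ} : tens (fun _ : Fin M => (1 : Matrix (Fin 2) (Fin 2) ℂ)) = 1 := by
  ext x y
  simp only [tens, Matrix.one_apply]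
  by_cases h : x = y
  · simp [h]
  · obtain ⟨i, hi⟩ := Function.ne_iff.mp h
    rw [if_neg h]
    exact Finset.prod_eq_zero (Finset.mem_univ i) (by simp [hi])

lemma tens_single {M : ℕ} (x y : Fin M → Fin 2) :
    tens (fun i => Matrix.single (x i) (y i) (1 : ℂ)) = Matrix.single x y 1 := by
  ext u v
  simp only [tens, Matrix.single_apply]
  by_cases h : x = u ∧ y = v
  · obtain ⟨rfl, rfl⟩ := h; simp
  · rw [if_neg h]
    have : ∃ i, ¬ (x i = u i ∧ y i = v i) := by
      by_contra hc
      push Not at hc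
      exact h ⟨funext fun i => (hc i).1, funext fun i => (hc i).2⟩
    obtain ⟨i, hi⟩ := this
    exact Finset.prod_eq_zero (Finset.mem_univ i) (by simp [hi])

lemma tens_update {M : ℕ} (f : Fin M → Matrix (Fin 2) (Fin 2) ℂ) (j : Fin M)
    (c : Matrix (Fin 2) (Fin 2) ℂ) :
    tens (Function.update f j c) =
      ∑ a, ∑ b, c a b • tens (Function.update f j (Matrix.single a b 1)) := by
  have key : ∀ (d : Matrix (Fin 2) (Fin 2) ℂ) x y, tens (Function.update f j d) x y =
      d (x j) (y j) * ∏ i ∈ Finset.univ.erase j, f i (x i) (y i) := by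
    intro d x y
    simp only [tens]
    rw [← Finset.mul_prod_erase _ _ (Finset.mem_univ j)]
    congr 1
    · simp
    · refine Finset.prod_congr rfl fun i hi => ?_
      rw [Function.update_of_ne (Finset.ne_of_mem_erase hi)]
  ext x y
  simp only [Matrix.sum_apply, Matrix.smul_apply, key, smul_eq_mul, ← mul_assoc]
  simp only [← Finset.sum_mul]
  congr 1
  simp [Matrix.single_apply, ite_and]

/-- Truncation of a family after `s` sites. -/
def cut {M : ℕ} (s : ℕ) (f : Fin M → Matrix (Fin 2) (Fin 2) ℂ) :
    Fin M → Matrix (Fin 2) (Fin 2) ℂ := fun i => if (i : ℕ) < s then f i else 1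

lemma pauli3_sq : pauli3 * pauli3 = 1 := by
  ext i j; fin_cases i <;> fin_cases j <;> simp [pauli3, Matrix.mul_apply]

lemma pauli3_conj : pauli3ᴴ = pauli3 := by
  ext i j; fin_cases i <;> fin_cases j <;> simp [pauli3, Matrix.conjTranspose_apply]

lemma single00 : sigmaMinus * sigmaMinusᴴ = Matrix.single 0 0 1 := by
  ext i j; fin_cases i <;> fin_cases j <;> simp [sigmaMinus, Matrix.mul_apply]

lemma single11 : sigmaMinusᴴ * sigmaMinus = Matrix.single 1 1 1 := by
  ext i j; fin_cases i <;> fin_cases j <;> simp [sigmaMinus, Matrix.mul_apply]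

lemma single01 : sigmaMinus = Matrix.single 0 1 1 := by
  ext i j; fin_cases i <;> fin_cases j <;> simp [sigmaMinus]

lemma single10 : sigmaMinusᴴ = Matrix.single 1 0 1 := by
  ext i j; fin_cases i <;> fin_cases j <;> simp [sigmaMinus]

lemma jw_eq {M : ℕ} (j : Fin M) :
    jw M j = tens (Function.update (cut j fun _ => pauli3) j sigmaMinus) := by
  ext x y
  simp only [jw, tens]
  refine Finset.prod_congr rfl fun i _ => ?_
  by_cases h : i = j
  · subst h; simp
  · simp only [Function.update_of_ne h, cut, if_neg h]
    rfl

lemma jwc_eq {M : ℕ} (j : Fin M) :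
    (jw M j)ᴴ = tens (Function.update (cut j fun _ => pauli3) j sigmaMinusᴴ) := by
  rw [jw_eq, tens_conj]
  congr 1
  funext i
  by_cases h : i = j
  · subst h; simp
  · simp only [Function.update_of_ne h, cut]
    split_ifs <;> simp [pauli3_conj]

lemma cut_mul_jw {M : ℕ} (f : Fin M → Matrix (Fin 2) (Fin 2) ℂ) (j : Fin M)
    (d : Matrix (Fin 2) (Fin 2) ℂ) :
    tens (cut j f) * tens (Function.update (cut j fun _ => pauli3) j d) =
      tens (Function.update (cut j fun i => f i * pauli3) j d) := by
  rw [tens_mul]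
  congr 1
  funext i
  by_cases h : i = j
  · subst h; simp [cut]
  · simp only [Function.update_of_ne h, cut]
    split_ifs <;> simp

lemma upd_mul_jw {M : ℕ} (f : Fin M → Matrix (Fin 2) (Fin 2) ℂ) (j : Fin M)
    (c d : Matrix (Fin 2) (Fin 2) ℂ) :
    tens (Function.update (cut j f) j c) * tens (Function.update (cut j fun _ => pauli3) j d) =
      tens (Function.update (cut j fun i => f i * pauli3) j (c * d)) := by
  rw [tens_mul]
  congr 1
  funext i
  by_cases h : i = j
  · subst h; simp
  · simp only [Function.update_of_ne h, cut]
    split_ifs <;> simp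

lemma cut_step {M : ℕ} (S : Submodule ℂ (FockMat M)) (j : Fin M)
    (h0 : ∀ f, tens (cut (j : ℕ) f) ∈ S)
    (h1 : ∀ x ∈ S, x * jw M j ∈ S) (h2 : ∀ x ∈ S, x * (jw M j)ᴴ ∈ S)
    (f : Fin M → Matrix (Fin 2) (Fin 2) ℂ) : tens (cut ((j : ℕ) + 1) f) ∈ S := by
  have e : cut ((j : ℕ) + 1) f = Function.update (cut (j : ℕ) f) j (f j) := by
    funext i
    by_cases h : i = j
    · subst h; simp [cut]
    · have : (i : ℕ) ≠ j := fun hh => h (Fin.ext hh)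
      simp only [Function.update_of_ne h, cut]
      have : (i : ℕ) < j + 1 ↔ (i : ℕ) < j := by omega
      simp [this]
  have hz : (fun i => f i * pauli3 * pauli3) = f := by
    funext i; rw [mul_assoc, pauli3_sq, mul_one]
  have m1 : ∀ f, tens (Function.update (cut (j : ℕ) f) j sigmaMinus) ∈ S := by
    intro f
    have := h1 _ (h0 (fun i => f i * pauli3))
    rw [jw_eq, cut_mul_jw] at this
    simpa only [mul_assoc, pauli3_sq, mul_one] using this
  have m2 : ∀ f, tens (Function.update (cut (j : ℕ) f) j sigmaMinusᴴ) ∈ S := by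
    intro f
    have := h2 _ (h0 (fun i => f i * pauli3))
    rw [jwc_eq, cut_mul_jw] at this
    simpa only [mul_assoc, pauli3_sq, mul_one] using this
  have m3 := h2 _ (m1 (fun i => f i * pauli3))
  have m4 := h1 _ (m2 (fun i => f i * pauli3))
  rw [jwc_eq, upd_mul_jw, single00, hz] at m3
  rw [jw_eq, upd_mul_jw, single11, hz] at m4
  have m1 := m1 f
  have m2 := m2 f
  rw [single01] at m1
  rw [single10] at m2
  rw [e, tens_update]
  refine S.sum_mem fun a _ => S.sum_mem fun b _ => S.smul_mem _ ?_
  fin_cases a <;> fin_cases b <;> assumption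

lemma jw_mem₁ {M m : ℕ} (j : Fin M) (h : (j : ℕ) < m) : jw M j ∈ fermionAlg₁ M m :=
  StarAlgebra.subset_adjoin ℂ _ ⟨j, h, rfl⟩

lemma jw_mem₂ {M m : ℕ} (j : Fin M) (h : m ≤ (j : ℕ)) : jw M j ∈ fermionAlg₂ M m :=
  StarAlgebra.subset_adjoin ℂ _ ⟨j, h, rfl⟩

lemma cut_mem₁ {M m : ℕ} (hmM : m < M) (s : ℕ) (hs : s ≤ m) :
    ∀ f : Fin M → Matrix (Fin 2) (Fin 2) ℂ, tens (cut s f) ∈ fermionAlg₁ M m := by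
  induction s with
  | zero =>
    intro f
    have e : cut 0 f = fun _ => 1 := by funext i; simp [cut]
    rw [e, tens_one]
    exact one_mem _
  | succ s ih =>
    exact cut_step (Subalgebra.toSubmodule (fermionAlg₁ M m).toSubalgebra) ⟨s, by omega⟩
      (ih (by omega))
      (fun x hx => mul_mem (S := StarSubalgebra ℂ (FockMat M)) hx (jw_mem₁ _ (show s < m by omega)))
      (fun x hx => mul_mem (S := StarSubalgebra ℂ (FockMat M)) hx
        (star_mem (jw_mem₁ (M := M) (m := m) ⟨s, by omega⟩ (show s < m by omega))))

/-- Span of products. -/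
def prodSpan (M m : ℕ) : Submodule ℂ (FockMat M) :=
  Submodule.span ℂ {x | ∃ α₁ ∈ fermionAlg₁ M m, ∃ α₂ ∈ fermionAlg₂ M m, x = α₁ * α₂}

lemma prodSpan_mul {M m : ℕ} (x : FockMat M) (hx : x ∈ prodSpan M m) (b : FockMat M)
    (hb : b ∈ fermionAlg₂ M m) : x * b ∈ prodSpan M m := by
  unfold prodSpan at *
  induction hx using Submodule.span_induction with
  | mem x h =>
    obtain ⟨a, ha, c, hc, rfl⟩ := h
    exact Submodule.subset_span ⟨a, ha, c * b, mul_mem hc hb, by rw [mul_assoc]⟩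
  | zero => simp
  | add x y _ _ h1 h2 => rw [add_mul]; exact add_mem h1 h2
  | smul c x _ h => rw [smul_mul_assoc]; exact Submodule.smul_mem _ _ h

lemma cut_memSpan {M m : ℕ} (hmM : m < M) (s : ℕ) (hs : m ≤ s) (hsM : s ≤ M) :
    ∀ f : Fin M → Matrix (Fin 2) (Fin 2) ℂ, tens (cut s f) ∈ prodSpan M m := by
  induction s, hs using Nat.le_induction with
  | base =>
    intro f
    exact Submodule.subset_span ⟨_, cut_mem₁ hmM m le_rfl f, 1, one_mem _, by rw [mul_one]⟩
  | succ s hs ih =>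
    exact cut_step (prodSpan M m) ⟨s, by omega⟩ (ih (by omega))
      (fun x hx => prodSpan_mul x hx _ (jw_mem₂ _ hs))
      (fun x hx => prodSpan_mul x hx _ 
        (star_mem (jw_mem₂ (M := M) (m := m) ⟨s, by omega⟩ hs)))

lemma prodSpan_top {M m : ℕ} (hmM : m < M) : prodSpan M m = ⊤ := by
  rw [eq_top_iff]
  intro x _
  rw [Matrix.matrix_eq_sum_single x]
  refine Submodule.sum_mem _ fun a _ => Submodule.sum_mem _ fun b _ => ?_
  have := cut_memSpan hmM M hmM.le le_rfl (fun i => Matrix.single (a i) (b i) 1)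
  have e : cut M (fun i => Matrix.single (a i) (b i) (1 : ℂ)) =
    fun i => Matrix.single (a i) (b i) 1 := by
    funext i; simp [cut]
  rw [e, tens_single] at this
  have h2 := Submodule.smul_mem _ (x a b) this
  simpa [Matrix.smul_single] using h2

lemma ext_prod {M m : ℕ} (hmM : m < M) (f g : FockMat M →ₗ[ℂ] ℂ)
    (h : ∀ α₁ ∈ fermionAlg₁ M m, ∀ α₂ ∈ fermionAlg₂ M m, f (α₁ * α₂) = g (α₁ * α₂)) : f = g := by
  refine LinearMap.ext_on (prodSpan_top (m := m) hmM) ?_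
  rintro x ⟨a, ha, b, hb, rfl⟩
  exact h a ha b hb

lemma jw_num {M : ℕ} (j : Fin M) : (jw M j)ᴴ * jw M j =
    Matrix.diagonal (fun x => if x j = 1 then (1 : ℂ) else 0) := by
  have h := upd_mul_jw (fun _ => pauli3) j sigmaMinusᴴ sigmaMinus
  rw [← jwc_eq, ← jw_eq, single11] at h
  rw [h]
  ext x y
  have e : (cut (j : ℕ) fun _ : Fin M => pauli3 * pauli3) = fun _ => 1 := by
    funext i; simp [cut, pauli3_sq]
  rw [e]
  simp only [tens, Matrix.diagonal_apply]
  by_cases hxy : x = y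
  · subst hxy
    rw [Finset.prod_eq_single j]
    · simp [Matrix.single_apply, eq_comm]
    · intro b _ hb; simp [Function.update_of_ne hb]
    · simp
  · obtain ⟨i, hi⟩ := Function.ne_iff.mp hxy
    rw [if_neg hxy]
    refine Finset.prod_eq_zero (Finset.mem_univ i) ?_
    by_cases hij : i = j
    · subst hij
      simp only [Function.update_self, Matrix.single_apply]
      rw [if_neg]
      rintro ⟨h1, h2⟩
      exact hi (h1.symm.trans h2)
    · simp [Function.update_of_ne hij, hi]

/-- Local occupation number. -/
def cnt (M m : ℕ) (x : Fin M → Fin 2) : ℕ :=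
  (Finset.univ.filter (fun j : Fin M => (j : ℕ) < m ∧ x j = 1)).card

lemma numberOp₁_eq (M m : ℕ) : numberOp₁ M m = Matrix.diagonal (fun x => (cnt M m x : ℂ)) := by
  unfold numberOp₁
  simp only [jw_num]
  ext x y
  simp only [Matrix.sum_apply, Matrix.diagonal_apply]
  by_cases h : x = y
  · simp [h, cnt, Finset.filter_filter]
  · simp [h]

lemma cnt_le {M m : ℕ} (x : Fin M → Fin 2) : cnt M m x ≤ m := by
  unfold cnt
  calc _ = ((Finset.univ.filter (fun j : Fin M => (j : ℕ) < m ∧ x j = 1)).map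
            Fin.valEmbedding).card := by simp
    _ ≤ (Finset.range m).card := by
        apply Finset.card_le_card
        intro i
        simp only [Finset.mem_map, Finset.mem_filter, Finset.mem_range]
        rintro ⟨a, ⟨_, h, _⟩, rfl⟩
        exact h
    _ = m := by simp

lemma proj_eq {M m : ℕ} (P : Fin (m + 1) → FockMat M)
    (hPherm : ∀ k, (P k)ᴴ = P k)
    (hPidem : ∀ k, P k * P k = P k)
    (hPrange : ∀ (k : Fin (m + 1)) (v : (Fin M → Fin 2) → ℂ),
      (numberOp₁ M m).mulVec v = ((k : ℕ) : ℂ) • v ↔ (P k).mulVec v = v) (k : Fin (m + 1)) :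
    P k = Matrix.diagonal (fun x => if cnt M m x = k then (1 : ℂ) else 0) := by
  set Q : FockMat M := Matrix.diagonal (fun x => if cnt M m x = k then (1 : ℂ) else 0) with hQ
  have hQh : Qᴴ = Q := by
    rw [hQ, Matrix.diagonal_conjTranspose]
    congr 1
    funext x
    simp [apply_ite]
  have h1 : P k * Q = Q := by
    apply Matrix.ext_of_mulVec_single
    intro i
    rw [← Matrix.mulVec_mulVec]
    apply (hPrange k _).1
    rw [numberOp₁_eq, hQ]
    ext x
    simp only [Matrix.mulVec_diagonal, Pi.smul_apply, smul_eq_mul]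
    by_cases h : cnt M m x = k <;> simp [h]
  have h2 : Q * P k = P k := by
    ext x y
    have h := congrFun ((hPrange k ((P k).mulVec (Pi.single y 1))).2
      (by rw [Matrix.mulVec_mulVec, hPidem])) x
    rw [numberOp₁_eq] at h
    simp only [Matrix.mulVec_diagonal, Pi.smul_apply, smul_eq_mul, Matrix.mulVec_single_one,
      Matrix.col_apply] at h
    rw [hQ, Matrix.diagonal_mul]
    by_cases hx : cnt M m x = k
    · simp [hx]
    · have : ((cnt M m x : ℂ) - k) * P k x y = 0 := by rw [sub_mul, h, sub_self]
      rcases mul_eq_zero.mp this with h' | h'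
      · exact absurd (by exact_mod_cast sub_eq_zero.mp h') hx
      · simp [h']
  have h3 := congrArg Matrix.conjTranspose h2
  rw [Matrix.conjTranspose_mul, hQh, hPherm] at h3
  exact h3.symm.trans h1

lemma cauchy {M : ℕ} (ω : FockMat M →ₗ[ℂ] ℂ) (hω : IsState ω) (x y : FockMat M)
    (h : ω (xᴴ * x) = 0) : ω (yᴴ * x) = 0 ∧ ω (xᴴ * y) = 0 := by
  set c := ω (yᴴ * x)
  set d := ω (xᴴ * y)
  set r := ω (yᴴ * y)
  have key : ∀ t : ℂ, 0 ≤ r + t * c + star t * d := by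
    intro t
    have := hω.1 (y + t • x)
    simp only [Matrix.conjTranspose_add, Matrix.conjTranspose_smul, add_mul, mul_add, map_add,
      smul_mul_assoc, mul_smul_comm, map_smul, smul_eq_mul, h] at this
    convert this using 1
    simp only [c, d, r]
    ring
  have real0 : ∀ r u : ℝ, (∀ s : ℝ, 0 ≤ r + s * u) → u = 0 := by
    intro r u hs
    by_contra hu
    have := hs (-(r + 1) / u)
    rw [div_mul_cancel₀ _ hu] at this
    linarith
  have K : ∀ t : ℂ, 0 ≤ (r + t * c + star t * d).re ∧ (r + t * c + star t * d).im = 0 := by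
    intro t
    have := Complex.le_def.1 (key t)
    simp only [Complex.zero_re, Complex.zero_im] at this
    exact ⟨this.1, this.2.symm⟩
  have a1 : c.re + d.re = 0 := real0 r.re _ fun s => by
    have := (K s).1
    simp at this
    linarith
  have a2 : -c.im + d.im = 0 := real0 r.re _ fun s => by
    have := (K (s * Complex.I)).1
    simp at this
    linarith
  have b0 := (K 0).2
  have b1 := (K 1).2
  have b2 := (K Complex.I).2
  simp at b0 b1 b2
  constructor <;> apply Complex.ext <;> simp <;> linarith

/-- Complementary number operator. -/
noncomputable def numberOp₂ (M m : ℕ) : FockMat M :=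
  ∑ j ∈ Finset.univ.filter (fun j : Fin M => ¬ (j : ℕ) < m), (jw M j)ᴴ * jw M j

lemma numberOp_split (M m : ℕ) : numberOp M = numberOp₁ M m + numberOp₂ M m := by
  unfold numberOp numberOp₁ numberOp₂
  rw [Finset.sum_filter_add_sum_filter_not]

lemma numberOp₁_mem (M m : ℕ) : numberOp₁ M m ∈ fermionAlg₁ M m :=
  sum_mem fun j hj => by
    have h := jw_mem₁ (m := m) j (Finset.mem_filter.1 hj).2
    exact mul_mem (star_mem h) h

lemma numberOp₂_mem (M m : ℕ) : numberOp₂ M m ∈ fermionAlg₂ M m :=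
  sum_mem fun j hj => by
    have h := jw_mem₂ (m := m) j (not_lt.1 (Finset.mem_filter.1 hj).2)
    exact mul_mem (star_mem h) h

lemma numSum_herm {M : ℕ} (s : Finset (Fin M)) :
    (∑ j ∈ s, (jw M j)ᴴ * jw M j)ᴴ = ∑ j ∈ s, (jw M j)ᴴ * jw M j := by
  simp [Matrix.conjTranspose_sum, Matrix.conjTranspose_mul]

lemma numSum_comm {M : ℕ} (s t : Finset (Fin M)) :
    (∑ j ∈ s, (jw M j)ᴴ * jw M j) * (∑ j ∈ t, (jw M j)ᴴ * jw M j) =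
    (∑ j ∈ t, (jw M j)ᴴ * jw M j) * (∑ j ∈ s, (jw M j)ᴴ * jw M j) := by
  have : Commute (∑ j ∈ s, (jw M j)ᴴ * jw M j) (∑ j ∈ t, (jw M j)ᴴ * jw M j) := by
    refine Commute.sum_left _ _ _ fun i _ => Commute.sum_right _ _ _ fun j _ => ?_
    rw [jw_num, jw_num]
    simp only [Commute, SemiconjBy, Matrix.diagonal_mul_diagonal, mul_comm]
  exact this

lemma numSum_nonneg {M : ℕ} (ω : FockMat M →ₗ[ℂ] ℂ) (hω : IsState ω) (s : Finset (Fin M)) :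
    0 ≤ ω (∑ j ∈ s, (jw M j)ᴴ * jw M j) := by
  rw [map_sum]
  exact Finset.sum_nonneg fun j _ => hω.1 _

/-- The sector projection. -/
noncomputable def sect (M m : ℕ) (k : Fin (m + 1)) : FockMat M :=
  Matrix.diagonal (fun x => if cnt M m x = k then (1 : ℂ) else 0)

lemma sect_sum (M m : ℕ) : ∑ k, sect M m k = 1 := by
  ext x y
  simp only [sect, Matrix.sum_apply, Matrix.diagonal_apply, Matrix.one_apply]
  by_cases h : x = y
  · simp only [h, if_true]
    rw [Finset.sum_eq_single (⟨cnt M m y, Nat.lt_succ_of_le (cnt_le y)⟩ : Fin (m + 1))]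
    · simp
    · intro b _ hb
      rw [if_neg]
      intro h'
      exact hb (Fin.ext h'.symm)
    · simp
  · simp [h]

lemma sect_num (M m : ℕ) (k : Fin (m + 1)) :
    sect M m k * numberOp₁ M m = ((k : ℕ) : ℂ) • sect M m k ∧
    numberOp₁ M m * sect M m k = ((k : ℕ) : ℂ) • sect M m k := by
  rw [numberOp₁_eq, sect, Matrix.diagonal_mul_diagonal, Matrix.diagonal_mul_diagonal,
    ← Matrix.diagonal_smul]
  constructor <;> congr 1 <;> funext x <;> by_cases h : cnt M m x = k <;> simp [h]

lemma variance_zero {M m : ℕ} (N : ℤ) (ω ω₁ ω₂ : FockMat M →ₗ[ℂ] ℂ)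
    (hω : IsState ω) (h₁ : IsState ω₁) (h₂ : IsState ω₂)
    (hp : ∀ α₁ ∈ fermionAlg₁ M m, ∀ α₂ ∈ fermionAlg₂ M m, ω (α₁ * α₂) = ω₁ α₁ * ω₂ α₂)
    (hN : ω ((numberOp M - (N : ℂ) • 1)ᴴ * (numberOp M - (N : ℂ) • 1)) = 0) :
    ∃ a : ℂ, (∀ y, ω (numberOp₁ M m * y) = a * ω y) ∧ ∀ y, ω (y * numberOp₁ M m) = a * ω y := by
  set a := ω (numberOp₁ M m) with ha
  set b := ω (numberOp₂ M m) with hb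
  have ha0 : 0 ≤ a := numSum_nonneg ω hω _
  have hb0 : 0 ≤ b := numSum_nonneg ω hω _
  have sa : star a = a := (IsSelfAdjoint.of_nonneg ha0)
  have sb : star b = b := (IsSelfAdjoint.of_nonneg hb0)
  have h1 : (numberOp₁ M m)ᴴ = numberOp₁ M m := numSum_herm _
  have h2 : (numberOp₂ M m)ᴴ = numberOp₂ M m := numSum_herm _
  have hc : numberOp₁ M m * numberOp₂ M m = numberOp₂ M m * numberOp₁ M m := numSum_comm _ _
  have m1 := numberOp₁_mem M m
  have m2 := numberOp₂_mem M m
  rw [numberOp_split M m] at hN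
  set X := numberOp₁ M m
  set Y := numberOp₂ M m
  have ea : ω₁ X = a := by
    have := hp X m1 1 (one_mem _)
    rw [mul_one, h₂.2, mul_one] at this
    exact this.symm
  have hXY : ω ((X - a • 1) * (Y - b • 1)) = 0 := by
    rw [hp _ (sub_mem m1 (SMulMemClass.smul_mem a (one_mem _))) _
      (sub_mem m2 (SMulMemClass.smul_mem b (one_mem _)))]
    simp [ea, h₁.2]
  have hX : ω (X - a • 1) = 0 := by simp [← ha, hω.2]
  have hY : ω (Y - b • 1) = 0 := by simp [← hb, hω.2]
  have cX : (X - a • 1)ᴴ = X - a • 1 := by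
    rw [Matrix.conjTranspose_sub, Matrix.conjTranspose_smul, h1, sa, Matrix.conjTranspose_one]
  have cY : (Y - b • 1)ᴴ = Y - b • 1 := by
    rw [Matrix.conjTranspose_sub, Matrix.conjTranspose_smul, h2, sb, Matrix.conjTranspose_one]
  have pX := hω.1 (X - a • 1)
  have pY := hω.1 (Y - b • 1)
  have hcomm : (Y - b • 1) * (X - a • 1) = (X - a • 1) * (Y - b • 1) := by
    simp only [sub_mul, mul_sub, smul_mul_assoc, mul_smul_comm, one_mul, mul_one, hc,
      smul_sub, smul_comm b a]
    abel
  set c := a + b - N with hcdef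
  have sc : star c = c := by simp [hcdef, sa, sb]
  have hD : X + Y - (N : ℂ) • 1 = (X - a • 1) + (Y - b • 1) + c • (1 : FockMat M) := by
    rw [hcdef, sub_smul, add_smul]; abel
  have pc : 0 ≤ c * c := by
    have := star_mul_self_nonneg c
    rwa [sc] at this
  rw [hD] at hN
  rw [cX] at pX
  rw [cY] at pY
  have key : ω ((X - a • 1) * (X - a • 1)) = 0 := by
    rw [Matrix.conjTranspose_add, Matrix.conjTranspose_add, cX, cY, Matrix.conjTranspose_smul, sc,
      Matrix.conjTranspose_one] at hN
    set U := X - a • 1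
    set V := Y - b • 1
    simp only [add_mul, mul_add, map_add, hcomm, hXY, smul_mul_assoc, mul_smul_comm, one_mul,
      mul_one, map_smul, hX, hY, hω.2, smul_eq_mul, mul_zero, add_zero, zero_add] at hN
    have h3 : ω (U * U) + (ω (V * V) + c * c) = 0 := by rw [← add_assoc]; exact hN
    exact ((add_eq_zero_iff_of_nonneg pX (add_nonneg pY pc)).1 h3).1
  have cs := fun y => cauchy ω hω (X - a • 1) y (by rw [cX]; exact key)
  refine ⟨a, fun y => ?_, fun y => ?_⟩
  · have := (cs y).2
    rw [cX, sub_mul, map_sub, smul_mul_assoc, one_mul, map_smul, smul_eq_mul] at this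
    exact sub_eq_zero.1 this
  · have := (cs yᴴ).1
    rw [Matrix.conjTranspose_conjTranspose, mul_sub, map_sub, mul_smul_comm, mul_one, map_smul,
      smul_eq_mul] at this
    exact sub_eq_zero.1 this

lemma sector {M m : ℕ} (N : ℤ) (ω ω₁ ω₂ : FockMat M →ₗ[ℂ] ℂ)
    (hω : IsState ω) (h₁ : IsState ω₁) (h₂ : IsState ω₂)
    (hp : ∀ α₁ ∈ fermionAlg₁ M m, ∀ α₂ ∈ fermionAlg₂ M m, ω (α₁ * α₂) = ω₁ α₁ * ω₂ α₂)
    (hN : ω ((numberOp M - (N : ℂ) • 1)ᴴ * (numberOp M - (N : ℂ) • 1)) = 0) :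
    ∃ a : Fin (m + 1), ∀ k l y, ω (sect M m k * y * sect M m l) =
      if k = a ∧ l = a then ω y else 0 := by
  obtain ⟨a, hl, hr⟩ := variance_zero N ω ω₁ ω₂ hω h₁ h₂ hp hN
  have hl' : ∀ (k : Fin (m + 1)) y, ((k : ℕ) : ℂ) ≠ a → ω (sect M m k * y) = 0 := by
    intro k y hk
    have := hl (sect M m k * y)
    rw [← mul_assoc, (sect_num M m k).2, smul_mul_assoc, map_smul, smul_eq_mul] at this
    exact (mul_eq_mul_right_iff.1 this).resolve_left hk
  have hr' : ∀ (k : Fin (m + 1)) y, ((k : ℕ) : ℂ) ≠ a → ω (y * sect M m k) = 0 := by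
    intro k y hk
    have := hr (y * sect M m k)
    rw [mul_assoc, (sect_num M m k).1, mul_smul_comm, map_smul, smul_eq_mul] at this
    exact (mul_eq_mul_right_iff.1 this).resolve_left hk
  have hex : ∃ k : Fin (m + 1), ((k : ℕ) : ℂ) = a := by
    by_contra hcon
    push Not at hcon
    have h := hω.2
    rw [← sect_sum M m, map_sum, Finset.sum_eq_zero] at h
    · exact zero_ne_one h
    · intro k _
      simpa using hl' k 1 (hcon k)
  obtain ⟨k₀, hk₀⟩ := hex
  have hne : ∀ k : Fin (m + 1), k ≠ k₀ → ((k : ℕ) : ℂ) ≠ a := by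
    intro k hk h
    rw [← hk₀] at h
    exact hk (Fin.ext (by exact_mod_cast h))
  have el : ∀ y, ω (sect M m k₀ * y) = ω y := by
    intro y
    conv_rhs => rw [← one_mul y, ← sect_sum M m, Finset.sum_mul, map_sum]
    rw [Finset.sum_eq_single k₀]
    · intro k _ hk; exact hl' k y (hne k hk)
    · simp
  have er : ∀ y, ω (y * sect M m k₀) = ω y := by
    intro y
    conv_rhs => rw [← mul_one y, ← sect_sum M m, Finset.mul_sum, map_sum]
    rw [Finset.sum_eq_single k₀]
    · intro k _ hk; exact hr' k y (hne k hk)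
    · simp
  refine ⟨k₀, fun k l y => ?_⟩
  by_cases hk : k = k₀
  · by_cases hl : l = k₀
    · subst hk; subst hl
      rw [er, el]; simp
    · rw [if_neg (fun h => hl h.2)]
      exact hr' l _ (hne l hl)
  · rw [if_neg (fun h => hk h.1), mul_assoc]
    exact hl' k _ (hne k hk)

/-- Trace functional. -/
noncomputable def trF {M : ℕ} (ρ : FockMat M) : FockMat M →ₗ[ℂ] ℂ :=
  (Matrix.traceLinearMap _ ℂ ℂ).comp (LinearMap.mulLeft ℂ ρ)

lemma trF_apply {M : ℕ} (ρ x : FockMat M) : trF ρ x = (ρ * x).trace := rfl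

lemma sep_forward (M m : ℕ) (hmM : m < M) (N : ℤ)
    (ρ : FockMat M) (hρN : numberOp M * ρ = (N : ℂ) • ρ) (h : IsSepDM M m ρ) :
      ((∀ k l : Fin (m + 1), k ≠ l → sect M m k * ρ * sect M m l = 0) ∧
        ∀ (k : Fin (m + 1)) (p : ℝ), (sect M m k * ρ * sect M m k).trace = (p : ℂ) → 0 < p →
          IsSepDM M m (((p : ℂ)⁻¹) • (sect M m k * ρ * sect M m k))) := by
  obtain ⟨n, lam, ω₁, ω₂, hlam, hsum, h₁, h₂, hex, htr⟩ := h
  choose ω hω hp using hex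
  have hall : ∀ x, (ρ * x).trace = ∑ i, (lam i : ℂ) * ω i x := by
    have := ext_prod hmM (trF ρ) (∑ i, (lam i : ℂ) • ω i) (by
      intro a ha b hb
      rw [trF_apply, htr a ha b hb]
      simp only [LinearMap.sum_apply, LinearMap.smul_apply, smul_eq_mul]
      exact Finset.sum_congr rfl fun i _ => by rw [hp i a ha b hb, mul_assoc])
    intro x
    have h := LinearMap.congr_fun this x
    rw [trF_apply] at h
    simpa using h
  have hsec : ∀ i, ∃ a : Fin (m + 1), ∀ k l y, (lam i : ℂ) * ω i (sect M m k * y * sect M m l) =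
      if k = a ∧ l = a then (lam i : ℂ) * ω i y else 0 := by
    intro i
    by_cases hi : lam i = 0
    · exact ⟨0, fun k l y => by simp [hi]⟩
    have hz := hall ((numberOp M - (N : ℂ) • 1)ᴴ * (numberOp M - (N : ℂ) • 1))
    rw [Matrix.trace_mul_comm, mul_assoc, sub_mul, hρN, smul_mul_assoc, one_mul, sub_self,
      mul_zero, Matrix.trace_zero] at hz
    have hz' := (Finset.sum_eq_zero_iff_of_nonneg (fun i _ =>
      mul_nonneg (by exact_mod_cast hlam i) ((hω i).1 _))).1 hz.symm i (Finset.mem_univ i)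
    have hz'' := (mul_eq_zero.1 hz').resolve_left (by exact_mod_cast hi)
    obtain ⟨a, ha⟩ := sector N (ω i) (ω₁ i) (ω₂ i) (hω i) (h₁ i) (h₂ i) (hp i) hz''
    refine ⟨a, fun k l y => ?_⟩
    rw [ha]
    split_ifs <;> simp
  choose a ha using hsec
  have hcyc : ∀ k l x, (sect M m k * ρ * sect M m l * x).trace =
      ∑ i, if l = a i ∧ k = a i then (lam i : ℂ) * ω i x else 0 := by
    intro k l x
    rw [mul_assoc, mul_assoc, Matrix.trace_mul_comm, mul_assoc, hall]
    exact Finset.sum_congr rfl fun i _ => ha i l k x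
  refine ⟨fun k l hkl => ?_, fun k p hpk hp0 => ?_⟩
  · refine Matrix.ext_iff_trace_mul_right.2 fun x => ?_
    rw [hcyc, zero_mul, Matrix.trace_zero]
    refine Finset.sum_eq_zero fun i _ => if_neg ?_
    rintro ⟨h1, h2⟩
    exact hkl (h2.trans h1.symm)
  · have hpc : (p : ℂ) ≠ 0 := by exact_mod_cast hp0.ne'
    refine ⟨n, fun i => if k = a i then p⁻¹ * lam i else 0, ω₁, ω₂, ?_, ?_, h₁, h₂,
      fun i => ⟨ω i, hω i, hp i⟩, ?_⟩
    · intro i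
      dsimp only
      split_ifs
      · exact mul_nonneg (inv_nonneg.2 hp0.le) (hlam i)
      · exact le_rfl
    · have h := hcyc k k 1
      rw [mul_one, hpk] at h
      simp only [and_self, (hω _).2, mul_one] at h
      have h' : p = ∑ i, if k = a i then lam i else 0 := by
        have : (p : ℂ) = ((∑ i, if k = a i then lam i else 0 : ℝ) : ℂ) := by
          rw [h]; push_cast
          exact Finset.sum_congr rfl fun i _ => by split_ifs <;> simp
        exact_mod_cast this
      have e : ∀ i, (if k = a i then p⁻¹ * lam i else 0) = p⁻¹ * (if k = a i then lam i else 0) :=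
        fun i => by split_ifs <;> simp
      simp only [e]
      rw [← Finset.mul_sum, ← h', inv_mul_cancel₀ hp0.ne']
    · intro α₁ hα₁ α₂ hα₂
      rw [smul_mul_assoc, Matrix.trace_smul, hcyc, smul_eq_mul, Finset.mul_sum]
      refine Finset.sum_congr rfl fun i _ => ?_
      rw [hp i _ hα₁ _ hα₂]
      by_cases hk : k = a i
      · simp [← hk]; ring
      · simp [hk]

lemma sep_convex (M m : ℕ) {ι : Type} [Fintype ι] (p : ι → ℝ) (σ : ι → FockMat M)
    (hp : ∀ i, 0 ≤ p i) (hs : ∑ i, p i = 1) (hσ : ∀ i, IsSepDM M m (σ i)) :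
    IsSepDM M m (∑ i, (p i : ℂ) • σ i) := by
  choose n lam ω₁ ω₂ hlam hsum h₁ h₂ hex htr using hσ
  let e := Fintype.equivFin (Σ i, Fin (n i))
  refine ⟨Fintype.card (Σ i, Fin (n i)), fun q => p (e.symm q).1 * lam _ (e.symm q).2,
    fun q => ω₁ _ (e.symm q).2, fun q => ω₂ _ (e.symm q).2, fun q => mul_nonneg (hp _) (hlam _ _),
    ?_, fun q => h₁ _ _, fun q => h₂ _ _, fun q => hex _ _, ?_⟩
  · rw [e.symm.sum_comp (fun q => p q.1 * lam q.1 q.2), Fintype.sum_sigma]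
    simp only [← Finset.mul_sum, hsum, mul_one, hs]
  · intro a ha b hb
    rw [e.symm.sum_comp (fun q => ((p q.1 * lam q.1 q.2 : ℝ) : ℂ) * ω₁ q.1 q.2 a * ω₂ q.1 q.2 b),
      Fintype.sum_sigma, Finset.sum_mul, Matrix.trace_sum]
    refine Finset.sum_congr rfl fun i _ => ?_
    rw [smul_mul_assoc, Matrix.trace_smul, htr i a ha b hb, smul_eq_mul, Finset.mul_sum]
    refine Finset.sum_congr rfl fun j _ => ?_
    push_cast
    ring

lemma sect_herm (M m : ℕ) (k : Fin (m + 1)) : (sect M m k)ᴴ = sect M m k := by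
  rw [sect, Matrix.diagonal_conjTranspose]
  congr 1
  funext x
  simp [apply_ite]

lemma sep_backward (M m : ℕ)
    (ρ : FockMat M) (hρpos : ρ.PosSemidef) (hρtr : ρ.trace = 1)
    (h1 : ∀ k l : Fin (m + 1), k ≠ l → sect M m k * ρ * sect M m l = 0)
    (h2 : ∀ (k : Fin (m + 1)) (p : ℝ), (sect M m k * ρ * sect M m k).trace = (p : ℂ) → 0 < p →
          IsSepDM M m (((p : ℂ)⁻¹) • (sect M m k * ρ * sect M m k))) : IsSepDM M m ρ := by
  have hdec : ρ = ∑ k, sect M m k * ρ * sect M m k := by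
    have : ρ = (∑ k, sect M m k) * ρ * (∑ l, sect M m l) := by rw [sect_sum, one_mul, mul_one]
    conv_lhs => rw [this]
    rw [Finset.sum_mul, Finset.sum_mul]
    refine Finset.sum_congr rfl fun k _ => ?_
    rw [Finset.mul_sum, Finset.sum_eq_single k]
    · intro l _ hl; exact h1 k l hl.symm
    · simp
  have hpos : ∀ k, (sect M m k * ρ * sect M m k).PosSemidef := by
    intro k
    have := hρpos.mul_mul_conjTranspose_same (sect M m k)
    rwa [sect_herm] at this
  have hreal : ∀ k, ∃ p : ℝ, 0 ≤ p ∧ (sect M m k * ρ * sect M m k).trace = (p : ℂ) := by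
    intro k
    have h := (hpos k).trace_nonneg
    obtain ⟨hr, hi⟩ := Complex.le_def.1 h
    exact ⟨_, hr, Complex.ext rfl hi.symm⟩
  choose p hp0 hp using hreal
  have hzero : ∀ k, ¬ 0 < p k → sect M m k * ρ * sect M m k = 0 := by
    intro k hk
    have : p k = 0 := le_antisymm (not_lt.1 hk) (hp0 k)
    apply (hpos k).trace_eq_zero_iff.1
    rw [hp, this]; simp
  have hsum : ∑ k, p k = 1 := by
    have : ((∑ k, p k : ℝ) : ℂ) = 1 := by
      push_cast
      simp only [← hp]
      rw [← Matrix.trace_sum, ← hdec, hρtr]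
    exact_mod_cast this
  have key := sep_convex M m (ι := {k // 0 < p k}) (fun k => p k)
    (fun k => ((p k : ℂ)⁻¹) • (sect M m k * ρ * sect M m k)) (fun k => hp0 k) (by
      rw [← hsum, ← Finset.sum_filter_of_ne (p := fun k => 0 < p k)
        (fun k _ hk => lt_of_le_of_ne (hp0 k) (Ne.symm hk))]
      exact (Finset.sum_subtype _ (by simp) p).symm) (fun k => h2 k _ (hp k) k.2)
  convert key using 1
  have e : ∀ k : {k // 0 < p k}, (p k : ℂ) • ((p k : ℂ)⁻¹) • (sect M m k * ρ * sect M m k) =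
      sect M m k * ρ * sect M m k := by
    intro k
    have : (p k : ℂ) ≠ 0 := by exact_mod_cast k.2.ne'
    rw [smul_smul, mul_inv_cancel₀ this, one_smul]
  simp only [e]
  conv_lhs => rw [hdec]
  rw [← Finset.sum_filter_of_ne (p := fun k => 0 < p k)
    (fun k _ hk => by by_contra hc; exact hk (hzero k hc))]
  exact Finset.sum_subtype _ (by simp) (fun k => sect M m k * ρ * sect M m k)

/-- **Proposition 2**: a density matrix with fixed total fermion number `N` is
`(A₁,A₂)`-separable iff it has no coherences between different eigenvalues of the
local number operator `N̂₁` and each of its normalized diagonal blocks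
`P_k ρ P_k / p_k` is separable. -/
theorem fixed_number_separability
    (M m : ℕ) (hm0 : 0 < m) (hmM : m < M) (N : ℤ)
    (ρ : FockMat M) (hρpos : ρ.PosSemidef) (hρtr : ρ.trace = 1)
    (hρN : numberOp M * ρ = (N : ℂ) • ρ)
    -- `P k` is the orthogonal projection onto the eigenspace of `N̂₁` with
    -- eigenvalue `k`, for `k = 0, …, m`:
    (P : Fin (m + 1) → FockMat M)
    (hPherm : ∀ k, (P k)ᴴ = P k)
    (hPidem : ∀ k, P k * P k = P k)
    (hPrange : ∀ (k : Fin (m + 1)) (v : (Fin M → Fin 2) → ℂ),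
      (numberOp₁ M m).mulVec v = ((k : ℕ) : ℂ) • v ↔ (P k).mulVec v = v) :
    IsSepDM M m ρ ↔
      ((∀ k l : Fin (m + 1), k ≠ l → P k * ρ * P l = 0) ∧
        ∀ (k : Fin (m + 1)) (p : ℝ), (P k * ρ * P k).trace = (p : ℂ) → 0 < p →
          IsSepDM M m (((p : ℂ)⁻¹) • (P k * ρ * P k))) := by
  have hP : P = sect M m := by
    funext k
    exact proj_eq P hPherm hPidem hPrange k
  subst hP
  exact ⟨sep_forward M m hmM N ρ hρN, fun h => sep_backward M m ρ hρpos hρtr h.1 h.2⟩
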